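/- arXiv:2006.11491 — 3 statements merged into one kernel-verified Lean document; each statement's English description precedes it below -/
import Mathlib

section
/- Let a and b be coprime positive integers. Then the ring homomorphism ℤ[ζ_a] ⊗_ℤ ℤ[ζ_b] → ℤ[ζ_{ab}] induced by multiplication (x ⊗ y ↦ xy) is an isomorphism of rings. -/
/-- The ring `ℤ[ζ]` generated by a primitive `n`-th root of unity is free of finite rank over `ℤ`,
of rank `φ(n)`. -/
theorem IsPrimitiveRoot.free_finite_finrank_adjoin_int {n : ℕ} {ζ : ℂ} (hζ : IsPrimitiveRoot ζ n)
    (hn : 0 < n) :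
    Module.Free ℤ (Algebra.adjoin ℤ ({ζ} : Set ℂ)) ∧
      Module.Finite ℤ (Algebra.adjoin ℤ ({ζ} : Set ℂ)) ∧
      Module.finrank ℤ (Algebra.adjoin ℤ ({ζ} : Set ℂ)) = n.totient := by
  let B := Algebra.adjoin.powerBasis' (hζ.isIntegral hn)
  refine ⟨Module.Free.of_basis B.basis, B.finite, ?_⟩
  rw [B.finrank, Algebra.adjoin.powerBasis'_dim, ← Polynomial.cyclotomic_eq_minpoly hζ hn,
    Polynomial.natDegree_cyclotomic]

/-- A surjective linear map between finite free modules of the same rank is bijective. -/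
theorem LinearMap.bijective_of_surjective_of_finrank_eq {R M N : Type*} [CommRing R] [Nontrivial R]
    [AddCommGroup M] [Module R M] [Module.Free R M] [Module.Finite R M]
    [AddCommGroup N] [Module R N] [Module.Free R N] [Module.Finite R N]
    (h : Module.finrank R M = Module.finrank R N) {f : M →ₗ[R] N} (hf : Function.Surjective f) :
    Function.Bijective f := by
  let e := LinearEquiv.ofFinrankEq N M h.symm
  refine ⟨?_, hf⟩
  have hinj : Function.Injective (e.toLinearMap ∘ₗ f) :=
    OrzechProperty.injective_of_surjective_endomorphism _ (e.surjective.comp hf)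
  exact Function.Injective.of_comp hinj

/-- If `z` is a product of powers of `x` and `y`, then multiplication maps `R[x] ⊗ R[y]` onto any
ring `R[z]` that contains `R[x]` and `R[y]`. -/
theorem Algebra.TensorProduct.productMap_inclusion_adjoin_surjective {R A : Type*} [CommRing R]
    [CommRing A] [Algebra R A] {x y z : A}
    (hx : Algebra.adjoin R {x} ≤ Algebra.adjoin R {z})
    (hy : Algebra.adjoin R {y} ≤ Algebra.adjoin R {z}) {m n : ℕ} (h : x ^ m * y ^ n = z) :
    Function.Surjective (Algebra.TensorProduct.productMap
      (Subalgebra.inclusion hx) (Subalgebra.inclusion hy)) := by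
  set f := Algebra.TensorProduct.productMap (Subalgebra.inclusion hx) (Subalgebra.inclusion hy)
  have hle : Algebra.adjoin R {z} ≤ f.range.map (Algebra.adjoin R {z}).val := by
    refine Algebra.adjoin_le (Set.singleton_subset_iff.2 ?_)
    let x' : Algebra.adjoin R {x} := ⟨x, Algebra.self_mem_adjoin_singleton R x⟩
    let y' : Algebra.adjoin R {y} := ⟨y, Algebra.self_mem_adjoin_singleton R y⟩
    refine ⟨f ((x' ^ m) ⊗ₜ[R] (y' ^ n)), ⟨_, rfl⟩, ?_⟩
    simp [f, x', y', h]
  intro w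
  obtain ⟨_, ⟨t, rfl⟩, ht⟩ := hle w.2
  exact ⟨t, Subtype.ext ht⟩

/-- For coprime positive integers `a`, `b`, with `ζ_n = exp(2πi/n)`, the multiplication
map `ℤ[ζ_a] ⊗[ℤ] ℤ[ζ_b] → ℤ[ζ_{ab}]` is an isomorphism of rings. -/
theorem cyclotomic_int_tensor_bijective
    (a b : ℕ) (ha : 0 < a) (hb : 0 < b) (hab : Nat.Coprime a b)
    (ζa ζb ζab : ℂ)
    (hζa : ζa = Complex.exp (2 * (Real.pi : ℂ) * Complex.I / (a : ℂ)))
    (hζb : ζb = Complex.exp (2 * (Real.pi : ℂ) * Complex.I / (b : ℂ)))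
    (hζab : ζab = Complex.exp (2 * (Real.pi : ℂ) * Complex.I / ((a : ℂ) * (b : ℂ))))
    (h₁ : Algebra.adjoin ℤ ({ζa} : Set ℂ) ≤ Algebra.adjoin ℤ ({ζab} : Set ℂ))
    (h₂ : Algebra.adjoin ℤ ({ζb} : Set ℂ) ≤ Algebra.adjoin ℤ ({ζab} : Set ℂ)) :
    Function.Bijective
      (Algebra.TensorProduct.productMap
        (Subalgebra.inclusion h₁) (Subalgebra.inclusion h₂)) := by
  have pa : IsPrimitiveRoot ζa a := hζa ▸ Complex.isPrimitiveRoot_exp a ha.ne'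
  have pb : IsPrimitiveRoot ζb b := hζb ▸ Complex.isPrimitiveRoot_exp b hb.ne'
  have hpos : 0 < a * b := Nat.mul_pos ha hb
  have pab : IsPrimitiveRoot ζab (a * b) := by
    rw [hζab, ← Nat.cast_mul]
    exact Complex.isPrimitiveRoot_exp _ hpos.ne'
  have pmul : IsPrimitiveRoot (ζa * ζb) (a * b) := by
    rw [pa.eq_orderOf, pb.eq_orderOf] at hab ⊢
    rw [← (Commute.all ζa ζb).orderOf_mul_eq_mul_orderOf_of_coprime hab]
    exact IsPrimitiveRoot.orderOf _
  have : NeZero (a * b) := ⟨hpos.ne'⟩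
  obtain ⟨k, -, hk⟩ := pmul.eq_pow_of_pow_eq_one pab.pow_eq_one
  rw [mul_pow] at hk
  obtain ⟨_, _, ra⟩ := pa.free_finite_finrank_adjoin_int ha
  obtain ⟨_, _, rb⟩ := pb.free_finite_finrank_adjoin_int hb
  obtain ⟨_, _, rab⟩ := pab.free_finite_finrank_adjoin_int hpos
  have hsurj := Algebra.TensorProduct.productMap_inclusion_adjoin_surjective h₁ h₂ hk
  refine LinearMap.bijective_of_surjective_of_finrank_eq ?_
    (f := (Algebra.TensorProduct.productMap
      (Subalgebra.inclusion h₁) (Subalgebra.inclusion h₂)).toLinearMap) hsurj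
  rw [Module.finrank_tensorProduct, ra, rb, rab, Nat.totient_mul hab]
end

section
/- Let p be a prime number, r ≥ 1 an integer, ℓ = p^r, and let m be a positive integer coprime to p. Set ζ_ℓ = ζ_{ℓm}^m ∈ ℤ[ζ_{ℓm}]. Then the quotient ring ℤ[ζ_{ℓm}]/(ζ_ℓ − 1) is isomorphic to 𝔽_p[x]/(Φ̄_m(x)), where Φ̄_m ∈ 𝔽_p[x] is the reduction modulo p of the m-th cyclotomic polynomial Φ_m ∈ ℤ[x]. In particular, ℤ[ζ_{ℓm}]/(ζ_ℓ − 1) is a nonzero ring. -/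
open Polynomial

/-- The evaluation map from integer polynomials at a single generator is onto. -/
theorem aeval_adjoin_singleton_surjective {R S : Type*} [CommRing R] [CommRing S] [Algebra R S]
    (x : S) :
    Function.Surjective
      (aeval (⟨x, Algebra.self_mem_adjoin_singleton R x⟩ : Algebra.adjoin R ({x} : Set S)) :
        R[X] → Algebra.adjoin R ({x} : Set S)) := by
  rintro ⟨y, hy⟩
  rw [Algebra.adjoin_singleton_eq_range_aeval] at hy
  obtain ⟨f, rfl⟩ := hy
  refine ⟨f, Subtype.ext ?_⟩
  simp

/-- If `x ^ ℓ` is a primitive `m`-th root of unity and `ℓ` is coprime to `m`, some power of `x`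
with exponent congruent to `1` modulo `m` is also a primitive `m`-th root of unity. -/
theorem exists_isPrimitiveRoot_pow_of_coprime {M : Type*} [CommMonoid M] {x : M} {ℓ m : ℕ}
    (hm : 0 < m) (hc : ℓ.Coprime m) (hx : IsPrimitiveRoot (x ^ ℓ) m) :
    ∃ e : ℕ, e ≡ 1 [MOD m] ∧ IsPrimitiveRoot (x ^ e) m := by
  refine ⟨ℓ ^ m.totient, Nat.ModEq.pow_totient hc, ?_⟩
  obtain ⟨k, hk⟩ := Nat.exists_eq_succ_of_ne_zero (Nat.totient_pos.2 hm).ne'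
  rw [hk, pow_succ', pow_mul]
  exact hx.pow_of_coprime _ (Nat.Coprime.pow_left k hc)

/-- Over a ring of characteristic `p`, `Φ_m` divides `Φ_{p ^ r * m}`. -/
theorem cyclotomic_dvd_cyclotomic_prime_pow_mul (R : Type*) [CommRing R] {p r m : ℕ}
    [Fact p.Prime] [CharP R p] (hr : 1 ≤ r) (hpm : m.Coprime p) :
    cyclotomic m R ∣ cyclotomic (p ^ r * m) R := by
  have hp : p.Prime := Fact.out
  have hd : ¬p ∣ m := (Nat.Prime.coprime_iff_not_dvd hp).1 hpm.symm
  rw [cyclotomic_mul_prime_pow_eq R hd (by omega)]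
  refine dvd_pow_self _ (Nat.sub_ne_zero_of_lt ?_)
  exact Nat.pow_lt_pow_right hp.one_lt (by omega)

/-- The kernel of reduction of integer polynomials modulo `p` and then modulo `g`. -/
theorem exists_eq_mul_add_C_mul_of_map_dvd_map {p : ℕ} {f g : ℤ[X]}
    (h : g.map (Int.castRingHom (ZMod p)) ∣ f.map (Int.castRingHom (ZMod p))) :
    ∃ u v : ℤ[X], f = g * u + C (p : ℤ) * v := by
  obtain ⟨u', hu'⟩ := h
  obtain ⟨u, rfl⟩ := map_surjective _ (ZMod.ringHom_surjective (Int.castRingHom (ZMod p))) u'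
  have hdvd : C (p : ℤ) ∣ f - g * u := by
    rw [C_dvd_iff_dvd_coeff]
    intro i
    rw [← CharP.intCast_eq_zero_iff (ZMod p) p, ← eq_intCast (Int.castRingHom (ZMod p)), ← coeff_map]
    simp [hu']
  obtain ⟨v, hv⟩ := hdvd
  exact ⟨u, v, by rw [← hv]; ring⟩

/-- For `ℓ = p^r` a prime power, `m` coprime to `p`, `ζ_{ℓm} = exp(2πi/(ℓm))` and
`ζ_ℓ = ζ_{ℓm}^m`, the quotient `ℤ[ζ_{ℓm}]/(ζ_ℓ - 1)` is isomorphic to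
`𝔽_p[x]/(Φ_m mod p)`; in particular it is a nonzero ring. -/
theorem cyclotomic_int_quot_sub_one_eq_Fp_cyclotomic
    (p r ℓ m : ℕ) (hp : p.Prime) (hr : 1 ≤ r) (hℓ : ℓ = p ^ r)
    (hm : 0 < m) (hpm : Nat.Coprime m p)
    (ζ : ℂ) (hζ : ζ = Complex.exp (2 * (Real.pi : ℂ) * Complex.I / ((ℓ : ℂ) * (m : ℂ))))
    (z : Algebra.adjoin ℤ ({ζ} : Set ℂ)) (hz : (z : ℂ) = ζ ^ m) :
    Nonempty ((Algebra.adjoin ℤ ({ζ} : Set ℂ) ⧸ Ideal.span {z - 1}) ≃+*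
      ((ZMod p)[X] ⧸
        Ideal.span {Polynomial.map (Int.castRingHom (ZMod p)) (Polynomial.cyclotomic m ℤ)})) ∧
    Nontrivial (Algebra.adjoin ℤ ({ζ} : Set ℂ) ⧸ Ideal.span {z - 1}) := by
  have : Fact p.Prime := ⟨hp⟩
  have hℓ0 : 0 < ℓ := hℓ ▸ pow_pos hp.pos r
  have hprim : IsPrimitiveRoot ζ (ℓ * m) := by
    rw [hζ]
    exact_mod_cast Complex.isPrimitiveRoot_exp (ℓ * m) (Nat.mul_pos hℓ0 hm).ne'
  let A := Algebra.adjoin ℤ ({ζ} : Set ℂ)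
  set w : A := ⟨ζ, Algebra.self_mem_adjoin_singleton ℤ ζ⟩
  have hwprim : IsPrimitiveRoot w (ℓ * m) :=
    IsPrimitiveRoot.of_map_of_injective (f := A.val) hprim Subtype.val_injective
  have hzw : z = w ^ m := Subtype.ext hz
  have hsurj : Function.Surjective (aeval w : ℤ[X] → A) := aeval_adjoin_singleton_surjective ζ
  set I : Ideal A := Ideal.span {z - 1}
  have hpI : (p : A) ∈ I := by
    have hzprim : IsPrimitiveRoot z ℓ :=
      hzw ▸ hwprim.pow (Nat.mul_pos hℓ0 hm) (mul_comm _ _)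
    have h0 : (cyclotomic ℓ A).eval z = 0 := hzprim.isRoot_cyclotomic hℓ0
    obtain ⟨k, rfl⟩ : ∃ k, r = k + 1 := ⟨r - 1, by omega⟩
    have h1 : (cyclotomic ℓ A).eval 1 = p := by rw [hℓ, eval_one_cyclotomic_prime_pow]
    have h2 := sub_dvd_eval_sub z 1 (cyclotomic ℓ A)
    rw [h0, h1, zero_sub, dvd_neg] at h2
    exact Ideal.mem_span_singleton.2 h2
  have hcycI : aeval w (cyclotomic m ℤ) ∈ I := by
    obtain ⟨e, he, hprime⟩ := exists_isPrimitiveRoot_pow_of_coprime hm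
      (hℓ ▸ (Nat.Coprime.pow_right r hpm).symm) (hwprim.pow (Nat.mul_pos hℓ0 hm) rfl)
    have h0 : aeval (w ^ e) (cyclotomic m ℤ) = 0 := by
      simpa [aeval_def, eval₂_eq_eval_map] using hprime.isRoot_cyclotomic hm
    have hq : (Ideal.Quotient.mk I w) ^ m = 1 := by
      rw [← map_pow, ← hzw, ← map_one (Ideal.Quotient.mk I), Ideal.Quotient.eq]
      exact Ideal.mem_span_singleton_self _
    have hqe : (Ideal.Quotient.mk I w) ^ e = Ideal.Quotient.mk I w := by
      rw [pow_eq_pow_mod e hq, he, ← pow_eq_pow_mod 1 hq, pow_one]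
    rw [← Ideal.Quotient.eq_zero_iff_mem, ← Ideal.Quotient.mkₐ_eq_mk ℤ, ← aeval_algHom_apply,
      Ideal.Quotient.mkₐ_eq_mk, ← hqe, ← map_pow, ← Ideal.Quotient.mkₐ_eq_mk ℤ,
      aeval_algHom_apply, h0, map_zero]
  set J : Ideal (ZMod p)[X] := Ideal.span {(cyclotomic m ℤ).map (Int.castRingHom (ZMod p))}
  let f₁ : ℤ[X] →+* A ⧸ I := (Ideal.Quotient.mk I).comp (aeval w : ℤ[X] →ₐ[ℤ] A).toRingHom
  let f₂ : ℤ[X] →+* (ZMod p)[X] ⧸ J :=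
    (Ideal.Quotient.mk J).comp (mapRingHom (Int.castRingHom (ZMod p)))
  have hs₁ : Function.Surjective f₁ := Ideal.Quotient.mk_surjective.comp hsurj
  have hs₂ : Function.Surjective f₂ := Ideal.Quotient.mk_surjective.comp
    (map_surjective _ (ZMod.ringHom_surjective (Int.castRingHom (ZMod p))))
  have hk₁ (f : ℤ[X]) : f ∈ RingHom.ker f₁ ↔ aeval w f ∈ I := Ideal.Quotient.eq_zero_iff_mem
  have hk₂ (f : ℤ[X]) : f ∈ RingHom.ker f₂ ↔ (cyclotomic m ℤ).map (Int.castRingHom (ZMod p)) ∣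
      f.map (Int.castRingHom (ZMod p)) :=
    Ideal.Quotient.eq_zero_iff_mem.trans Ideal.mem_span_singleton
  have hker : RingHom.ker f₁ = RingHom.ker f₂ := by
    ext f
    rw [hk₁, hk₂]
    constructor
    · intro hf
      obtain ⟨a, ha⟩ := Ideal.mem_span_singleton.1 hf
      obtain ⟨g, rfl⟩ := hsurj a
      have h0 : aeval w (f - (X ^ m - 1) * g) = 0 := by simp [ha, hzw]
      have h0' : aeval ζ (f - (X ^ m - 1) * g) = 0 := by
        have := aeval_algHom_apply A.val w (f - (X ^ m - 1) * g)
        rwa [h0, map_zero] at this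
      have hdvd : cyclotomic (ℓ * m) ℤ ∣ f - (X ^ m - 1) * g := by
        rw [cyclotomic_eq_minpoly hprim (Nat.mul_pos hℓ0 hm)]
        exact minpoly.isIntegrallyClosed_dvd (hprim.isIntegral (Nat.mul_pos hℓ0 hm)) h0'
      have h1 := Polynomial.map_dvd (Int.castRingHom (ZMod p)) hdvd
      have h2 : (cyclotomic m ℤ).map (Int.castRingHom (ZMod p)) ∣
          ((X ^ m - 1) * g).map (Int.castRingHom (ZMod p)) :=
        Polynomial.map_dvd _ ((cyclotomic.dvd_X_pow_sub_one m ℤ).mul_right g)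
      have h3 : (cyclotomic m ℤ).map (Int.castRingHom (ZMod p)) ∣
          (cyclotomic (ℓ * m) ℤ).map (Int.castRingHom (ZMod p)) := by
        rw [map_cyclotomic, map_cyclotomic, hℓ]
        exact cyclotomic_dvd_cyclotomic_prime_pow_mul _ hr hpm
      have h4 := dvd_add (h3.trans h1) h2
      rwa [← Polynomial.map_add, sub_add_cancel] at h4
    · intro hf
      obtain ⟨u, v, rfl⟩ := exists_eq_mul_add_C_mul_of_map_dvd_map hf
      rw [map_add, map_mul, map_mul]
      refine I.add_mem (I.mul_mem_right _ hcycI) (I.mul_mem_right _ ?_)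
      simpa using hpI
  let e : (A ⧸ I) ≃+* ((ZMod p)[X] ⧸ J) :=
    (RingHom.quotientKerEquivOfSurjective hs₁).symm.trans
      ((Ideal.quotEquivOfEq hker).trans (RingHom.quotientKerEquivOfSurjective hs₂))
  have hJ : Nontrivial ((ZMod p)[X] ⧸ J) := by
    rw [Ideal.Quotient.nontrivial_iff, Ne, Ideal.span_singleton_eq_top, map_cyclotomic]
    intro hu
    have := natDegree_eq_zero_of_isUnit hu
    rw [natDegree_cyclotomic] at this
    exact (Nat.totient_pos.2 hm).ne' this
  exact ⟨⟨e⟩, e.toEquiv.nontrivial⟩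
end

section
/- Let p be a prime number, r ≥ 1 an integer, ℓ = p^r, and let m be a positive integer coprime to p. Then ζ_ℓ − 1 (where ζ_ℓ = ζ_{ℓm}^m) is not a unit of ℤ[ζ_{ℓm}], and the quotient ℤ[ζ_{ℓm}]/(ζ_ℓ − 1) is an 𝔽_p-algebra of dimension φ(m) over 𝔽_p, where φ is Euler's totient function. -/
set_option synthInstance.maxHeartbeats 1000000
set_option maxHeartbeats 1000000

open Polynomial in
/-- In characteristic `p`, the polynomials `Φ_{p^r m}` and `X^m - 1` generate an ideal that
contains `Φ_m`. -/
theorem exists_cyclotomic_eq_mul_add_mul {p r m : ℕ} [Fact p.Prime] (hr : 0 < r)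
    (hpm : ¬ p ∣ m) :
    ∃ a b : (ZMod p)[X], cyclotomic m (ZMod p) =
      a * cyclotomic (p ^ r * m) (ZMod p) + b * (X ^ m - 1) := by
  obtain ⟨P, hP⟩ := cyclotomic.dvd_X_pow_sub_one m (ZMod p)
  have hsep : (cyclotomic m (ZMod p) * P).Separable := by
    rw [← hP, X_pow_sub_one_separable_iff]
    rwa [Ne, CharP.cast_eq_zero_iff (ZMod p) p]
  obtain ⟨k, hk⟩ : ∃ k, p ^ r - p ^ (r - 1) = k + 1 := by
    refine Nat.exists_eq_add_one.mpr (Nat.sub_pos_of_lt ?_)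
    exact Nat.pow_lt_pow_right (Fact.out : p.Prime).one_lt (by lia)
  obtain ⟨a, b, hab⟩ := hsep.isCoprime.pow_left (m := k)
  refine ⟨a, b, ?_⟩
  rw [cyclotomic_mul_prime_pow_eq (ZMod p) hpm hr, hk, hP]
  linear_combination (-cyclotomic m (ZMod p)) * hab

open Polynomial in
theorem aeval_cyclotomic_eq_zero_of_pow_eq_one {p r m : ℕ} [Fact p.Prime] (hr : 0 < r)
    (hpm : ¬ p ∣ m) {A : Type*} [CommRing A] [Algebra (ZMod p) A] {x : A} (hx : x ^ m = 1)
    (h : aeval x (cyclotomic (p ^ r * m) (ZMod p)) = 0) :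
    aeval x (cyclotomic m (ZMod p)) = 0 := by
  obtain ⟨a, b, hab⟩ := exists_cyclotomic_eq_mul_add_mul (p := p) hr hpm
  rw [hab]
  simp [h, hx]

open Polynomial in
theorem aeval_cyclotomic_eq_aeval_cyclotomic_int (n : ℕ) (k : Type*) [CommRing k]
    {A : Type*} [CommRing A] [Algebra k A] [Algebra ℤ A] (x : A) :
    aeval x (cyclotomic n k) = aeval x (cyclotomic n ℤ) := by
  simp only [aeval_def, ← eval_map, map_cyclotomic]

open Polynomial in
theorem aeval_root_cyclotomic_prime_pow_mul {p r m : ℕ} [Fact p.Prime] (hr : 0 < r)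
    (hpm : ¬ p ∣ m) :
    aeval (AdjoinRoot.root (cyclotomic m (ZMod p))) (cyclotomic (p ^ r * m) ℤ) = 0 := by
  rw [← aeval_cyclotomic_eq_aeval_cyclotomic_int _ (ZMod p),
    cyclotomic_mul_prime_pow_eq (ZMod p) hpm hr, map_pow, AdjoinRoot.aeval_eq, AdjoinRoot.mk_self,
    zero_pow]
  exact (Nat.sub_pos_of_lt (Nat.pow_lt_pow_right (Fact.out : p.Prime).one_lt (by lia))).ne'

open Polynomial in
theorem root_cyclotomic_pow_eq_one (m : ℕ) (k : Type*) [CommRing k] :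
    AdjoinRoot.root (cyclotomic m k) ^ m = 1 := by
  have h := AdjoinRoot.mk_eq_zero.mpr (cyclotomic.dvd_X_pow_sub_one m k)
  rwa [map_sub, map_pow, AdjoinRoot.mk_X, map_one, sub_eq_zero] at h

open Polynomial in
theorem finrank_adjoinRoot_cyclotomic (m : ℕ) (k : Type*) [Field k] :
    Module.finrank k (AdjoinRoot (cyclotomic m k)) = m.totient := by
  rw [(AdjoinRoot.powerBasis' (cyclotomic.monic m k)).finrank, AdjoinRoot.powerBasis'_dim,
    natDegree_cyclotomic]

namespace IsPrimitiveRoot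

open Polynomial

variable {K : Type*} [Field K] {ζ : K} {p r m : ℕ}

theorem natCast_mem_span_pow_sub_one [Fact p.Prime] (hr : 0 < r)
    (hζ : IsPrimitiveRoot ζ (p ^ r * m)) (hm : 0 < m) {x : Algebra.adjoin ℤ {ζ}}
    (hx : (x : K) = ζ) : (p : Algebra.adjoin ℤ {ζ}) ∈ Ideal.span {x ^ m - 1} := by
  have hn : 0 < p ^ r * m := Nat.mul_pos (Nat.pow_pos (Fact.out : p.Prime).pos) hm
  have hroot : eval (x ^ m) (cyclotomic (p ^ r) (Algebra.adjoin ℤ {ζ})) = 0 := by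
    have hxp : IsPrimitiveRoot x (p ^ r * m) :=
      IsPrimitiveRoot.of_map_of_injective (f := (Algebra.adjoin ℤ {ζ}).val) (by simpa [hx])
        Subtype.val_injective
    exact (hxp.pow hn (mul_comm _ _)).isRoot_cyclotomic (Nat.pow_pos (Fact.out : p.Prime).pos)
  have hdvd := sub_dvd_eval_sub (x ^ m) 1 (cyclotomic (p ^ r) (Algebra.adjoin ℤ {ζ}))
  obtain ⟨k, rfl⟩ := Nat.exists_eq_add_one.mpr hr
  rw [hroot, eval_one_cyclotomic_prime_pow, zero_sub, dvd_neg] at hdvd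
  exact Ideal.mem_span_singleton.mpr hdvd

variable [CharZero K]

/-- There is a ring homomorphism `ℤ[ζ] → 𝔽_p[X]/(Φ_m)` sending a primitive `p^r m`-th root of
unity `ζ` to the class of `X`. -/
theorem exists_adjoin_algHom_adjoinRoot [Fact p.Prime] (hr : 0 < r) (hpm : ¬ p ∣ m)
    (hζ : IsPrimitiveRoot ζ (p ^ r * m)) (hm : 0 < m) :
    ∃ f : Algebra.adjoin ℤ {ζ} →ₐ[ℤ] AdjoinRoot (cyclotomic m (ZMod p)),
      f ⟨ζ, Algebra.self_mem_adjoin_singleton ℤ ζ⟩ = AdjoinRoot.root _ := by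
  have hn : 0 < p ^ r * m := Nat.mul_pos (Nat.pow_pos (Fact.out : p.Prime).pos) hm
  let pb := Algebra.adjoin.powerBasis' (hζ.isIntegral hn)
  have hpb : aeval (AdjoinRoot.root (cyclotomic m (ZMod p))) (minpoly ℤ pb.gen) = 0 := by
    rw [← Algebra.adjoin.powerBasis'_minpoly_gen, ← cyclotomic_eq_minpoly hζ hn]
    exact aeval_root_cyclotomic_prime_pow_mul hr hpm
  refine ⟨pb.lift _ hpb, ?_⟩
  rw [← Algebra.adjoin.powerBasis'_gen (hζ.isIntegral hn)]
  exact pb.lift_gen _ hpb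

/-- For `ζ` a primitive `p^r m`-th root of unity with `p ∤ m`, the quotient of `ℤ[ζ]` by
`ζ^m - 1` is `𝔽_p[X]/(Φ_m)`. -/
theorem nonempty_quotient_adjoin_ringEquiv [Fact p.Prime] (hr : 0 < r) (hpm : ¬ p ∣ m)
    (hζ : IsPrimitiveRoot ζ (p ^ r * m)) (hm : 0 < m) {x : Algebra.adjoin ℤ {ζ}}
    (hx : (x : K) = ζ) :
    Nonempty ((Algebra.adjoin ℤ {ζ} ⧸ Ideal.span {x ^ m - 1}) ≃+*
      AdjoinRoot (cyclotomic m (ZMod p))) := by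
  have hn : 0 < p ^ r * m := Nat.mul_pos (Nat.pow_pos (Fact.out : p.Prime).pos) hm
  obtain rfl : x = ⟨ζ, Algebra.self_mem_adjoin_singleton ℤ ζ⟩ := Subtype.ext hx
  set x : Algebra.adjoin ℤ {ζ} := ⟨ζ, Algebra.self_mem_adjoin_singleton ℤ ζ⟩
  set I : Ideal (Algebra.adjoin ℤ {ζ}) := Ideal.span {x ^ m - 1} with hI
  obtain ⟨f, hf⟩ := exists_adjoin_algHom_adjoinRoot hr hpm hζ hm
  have hfI : ∀ a ∈ I, (f : _ →+* AdjoinRoot (cyclotomic m (ZMod p))) a = 0 := by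
    have hle : I ≤ RingHom.ker (f : _ →+* AdjoinRoot (cyclotomic m (ZMod p))) := by
      rw [hI, Ideal.span_singleton_le_iff_mem, RingHom.mem_ker]
      rw [RingHom.coe_coe, map_sub, map_pow, hf, root_cyclotomic_pow_eq_one, map_one, sub_self]
    exact fun a ha ↦ hle ha
  let F := Ideal.Quotient.lift I (f : _ →+* AdjoinRoot (cyclotomic m (ZMod p))) hfI
  have hdeg : (cyclotomic m (ZMod p)).degree ≠ 0 := (degree_cyclotomic_pos m _ hm).ne'
  have : Nontrivial (AdjoinRoot (cyclotomic m (ZMod p))) := AdjoinRoot.nontrivial _ hdeg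
  have : Nontrivial (Algebra.adjoin ℤ {ζ} ⧸ I) := F.domain_nontrivial
  have hp0 : (p : Algebra.adjoin ℤ {ζ} ⧸ I) = 0 := by
    simpa using Ideal.Quotient.eq_zero_iff_mem.mpr (natCast_mem_span_pow_sub_one hr hζ hm hx)
  have : CharP (Algebra.adjoin ℤ {ζ} ⧸ I) p :=
    ringChar.of_eq (CharP.ringChar_of_prime_eq_zero Fact.out hp0)
  let _ : Algebra (ZMod p) (Algebra.adjoin ℤ {ζ} ⧸ I) := ZMod.algebra _ p
  have hxm : Ideal.Quotient.mk I x ^ m = 1 := by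
    rw [← map_pow, ← map_one (Ideal.Quotient.mk I), Ideal.Quotient.eq, hI]
    exact Ideal.mem_span_singleton_self _
  have hroot : aeval (Ideal.Quotient.mk I x) (cyclotomic (p ^ r * m) (ZMod p)) = 0 := by
    have h : IsPrimitiveRoot x (p ^ r * m) :=
      IsPrimitiveRoot.of_map_of_injective (f := (Algebra.adjoin ℤ {ζ}).val) hζ
        Subtype.val_injective
    have h0 := congrArg (Ideal.Quotient.mk I) (h.isRoot_cyclotomic hn).eq_zero
    rwa [map_zero, ← eval_map_apply, map_cyclotomic, ← map_cyclotomic _ (algebraMap (ZMod p) _),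
      eval_map_algebraMap] at h0
  let g : AdjoinRoot (cyclotomic m (ZMod p)) →ₐ[ZMod p] Algebra.adjoin ℤ {ζ} ⧸ I :=
    AdjoinRoot.liftAlgHom _ (Algebra.ofId _ _) (Ideal.Quotient.mk I x)
      (aeval_cyclotomic_eq_zero_of_pow_eq_one hr hpm hxm hroot)
  have hg : g (AdjoinRoot.root _) = Ideal.Quotient.mk I x := AdjoinRoot.liftAlgHom_root ..
  have hFx : F (Ideal.Quotient.mk I x) = AdjoinRoot.root _ := hf
  refine ⟨RingEquiv.ofRingHom F g.toRingHom ?_ ?_⟩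
  · refine AdjoinRoot.ringHom_ext (Subsingleton.elim _ _) ?_
    simp [hg, hFx]
  · refine Ideal.Quotient.ringHom_ext ?_
    have h : ((g.toRingHom.comp F).comp (Ideal.Quotient.mk I)).toIntAlgHom =
        (Ideal.Quotient.mk I).toIntAlgHom := by
      refine (Algebra.adjoin.powerBasis' (hζ.isIntegral hn)).algHom_ext ?_
      rw [Algebra.adjoin.powerBasis'_gen]
      exact (congrArg g hFx).trans hg
    exact RingHom.ext fun a ↦ DFunLike.congr_fun h a

end IsPrimitiveRoot

/-- For `ℓ = p^r` a prime power, `m` coprime to `p`, `ζ_{ℓm} = exp(2πi/(ℓm))` and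
`ζ_ℓ = ζ_{ℓm}^m`, the element `ζ_ℓ - 1` is not a unit of `ℤ[ζ_{ℓm}]`, and the quotient
`ℤ[ζ_{ℓm}]/(ζ_ℓ - 1)` is an `𝔽_p`-algebra of dimension `φ(m)` over `𝔽_p`. -/
theorem cyclotomic_int_quot_sub_one_dim_totient
    (p r ℓ m : ℕ) (hp : p.Prime) (hr : 1 ≤ r) (hℓ : ℓ = p ^ r)
    (hm : 0 < m) (hpm : Nat.Coprime m p)
    (ζ : ℂ) (hζ : ζ = Complex.exp (2 * (Real.pi : ℂ) * Complex.I / ((ℓ : ℂ) * (m : ℂ))))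
    (z : Algebra.adjoin ℤ ({ζ} : Set ℂ)) (hz : (z : ℂ) = ζ ^ m) :
    ¬ IsUnit (z - 1) ∧
    CharP (Algebra.adjoin ℤ ({ζ} : Set ℂ) ⧸ Ideal.span {z - 1}) p ∧
    ∀ a : Algebra (ZMod p) (Algebra.adjoin ℤ ({ζ} : Set ℂ) ⧸ Ideal.span {z - 1}),
      @Module.finrank (ZMod p) (Algebra.adjoin ℤ ({ζ} : Set ℂ) ⧸ Ideal.span {z - 1}) _ _
        (@Algebra.toModule _ _ _ _ a) = Nat.totient m := by
  have : Fact p.Prime := ⟨hp⟩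
  have hpm' : ¬ p ∣ m := fun h ↦ hp.ne_one (Nat.eq_one_of_dvd_coprimes hpm h dvd_rfl)
  have hprim : IsPrimitiveRoot ζ (p ^ r * m) := by
    have h := Complex.isPrimitiveRoot_exp (p ^ r * m)
      (Nat.mul_ne_zero (by simp [hp.ne_zero]) hm.ne')
    rwa [Nat.cast_mul, ← hℓ, ← hζ, hℓ] at h
  obtain ⟨e⟩ := hprim.nonempty_quotient_adjoin_ringEquiv hr hpm' hm
    (x := ⟨ζ, Algebra.self_mem_adjoin_singleton ℤ ζ⟩) rfl
  obtain rfl : z = ⟨ζ, Algebra.self_mem_adjoin_singleton ℤ ζ⟩ ^ m := Subtype.ext hz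
  have hdeg := (Polynomial.degree_cyclotomic_pos m (ZMod p) hm).ne'
  have : Nontrivial (AdjoinRoot (Polynomial.cyclotomic m (ZMod p))) := AdjoinRoot.nontrivial _ hdeg
  have hB : CharP (AdjoinRoot (Polynomial.cyclotomic m (ZMod p))) p :=
    charP_of_injective_algebraMap (algebraMap (ZMod p) _).injective p
  refine ⟨fun h ↦ ?_, (e.toRingHom.charP_iff e.injective p).mpr hB, fun a ↦ ?_⟩
  · exact (Ideal.Quotient.nontrivial_iff.mp e.toEquiv.nontrivial)
      (Ideal.span_singleton_eq_top.mpr h)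
  · let e' := AlgEquiv.ofRingEquiv (R := ZMod p) (f := e)
      (fun c ↦ DFunLike.congr_fun
        (Subsingleton.elim (e.toRingHom.comp (algebraMap (ZMod p) _)) (algebraMap (ZMod p) _)) c)
    rw [e'.toLinearEquiv.finrank_eq, finrank_adjoinRoot_cyclotomic]
end
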